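/- Let p be a prime with p > 3 and r an integer with r ≥ 2. Set P = −p^{3r} · C(2p^r−1, p^r−1)² / ((2p^r−1) · 4^{3p^r−3}). Then P · Σ_{k=(p^r+3)/2}^{p^r−1} ((−4)^k / C(2k,k)) · C(2p^r+2k−2, 2k−2) / (k(2k−1)) · C(2p^r−2, p^r−k−1) ≡ −(−1)^{(p^r−1)/2} · 3·p^{r+1}·q_p(2) (mod p^{r+2}). -/

import Mathlib

open Finset

/-- `a ≡ b (mod p^m)` for rationals: the `p`-adic valuation of `a - b` is at least `m`. -/
def pcong (p m : ℕ) (a b : ℚ) : Prop :=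
  a = b ∨ (m : ℤ) ≤ padicValRat p (a - b)

theorem factorial_two_mul_eq (m : ℕ) :
    ((2 * m).factorial : ℚ) = 2 ^ m * m.factorial * ∏ i ∈ range m, (2 * (i : ℚ) + 1) := by
  induction m with
  | zero => simp
  | succ m ih =>
    rw [show 2 * (m + 1) = 2 * m + 1 + 1 by ring, Nat.factorial_succ, Nat.factorial_succ,
      Nat.factorial_succ, prod_range_succ]
    push_cast
    rw [ih]
    ring

theorem prod_range_symm (x : ℚ) (j : ℕ) :
    ∏ i ∈ range (2 * j + 1), (x - 2 * j + 2 * i) =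
      x * ∏ i ∈ range j, (x ^ 2 - 4 * ((i : ℚ) + 1) ^ 2) := by
  induction j with
  | zero => simp
  | succ j ih =>
    rw [show 2 * (j + 1) + 1 = (2 * j + 1 + 1) + 1 by ring, prod_range_succ, prod_range_succ',
      prod_range_succ (fun i : ℕ ↦ x ^ 2 - 4 * ((i : ℚ) + 1) ^ 2), ← mul_assoc, ← ih]
    have : ∀ i ∈ range (2 * j + 1), (x - 2 * ((j + 1 : ℕ) : ℚ) + 2 * ((i + 1 : ℕ) : ℚ)) =
        x - 2 * j + 2 * i := by
      intro i _
      push_cast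
      ring
    rw [prod_congr rfl this]
    push_cast
    ring

theorem summand_eq_prod_odd (K l n : ℕ) (hn : n = K + 2 + l) :
    (-4 : ℚ) ^ (K + 1) / (((2 * (K + 1)).choose (K + 1) : ℕ) : ℚ) *
        (((2 * n + 2 * K).choose (2 * K) : ℕ) : ℚ) /
        (((K + 1 : ℕ) : ℚ) * (2 * (K + 1 : ℕ) - 1)) * (((2 * n - 2).choose l : ℕ) : ℚ) =
      (-1) ^ (K + 1) * 2 ^ (n + K) * (∏ i ∈ range (n + K), (2 * (i : ℚ) + 1)) /
        (n * (2 * n - 1) * (∏ i ∈ range (K + 1), (2 * (i : ℚ) + 1)) ^ 2 * l.factorial) := by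
  have h1 : 2 * n - 2 = l + (n + K) := by omega
  have h2 : (2 * n).factorial = 2 * n * (2 * n - 1) * (l + (n + K)).factorial := by
    rw [show 2 * n = (l + (n + K)) + 1 + 1 by omega, Nat.factorial_succ, Nat.factorial_succ,
      Nat.add_sub_cancel]
    ring
  have h3 : ((2 * n).factorial : ℚ) = 2 * n * (2 * n - 1) * (l + (n + K)).factorial := by
    rw [h2]
    push_cast [Nat.cast_sub (show 1 ≤ 2 * n by omega)]
    ring
  rw [h1, Nat.cast_add_choose, show 2 * n + 2 * K = 2 * K + 2 * n by ring, Nat.cast_add_choose,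
    show 2 * (K + 1) = (K + 1) + (K + 1) by ring, Nat.cast_add_choose, h3,
    show 2 * K + 2 * n = 2 * (n + K) by ring, show (K + 1) + (K + 1) = 2 * (K + 1) by ring,
    factorial_two_mul_eq (n + K), factorial_two_mul_eq K, factorial_two_mul_eq (K + 1)]
  have hO : ∀ m : ℕ, (∏ i ∈ range m, (2 * (i : ℚ) + 1)) ≠ 0 := fun m ↦
    prod_ne_zero_iff.2 fun i _ ↦ by positivity
  have hf : ∀ m : ℕ, (m.factorial : ℚ) ≠ 0 := fun m ↦ by positivity
  have hn0 : (n : ℚ) ≠ 0 := by rw [hn]; positivity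
  have hn1 : (2 * (n : ℚ) - 1) ≠ 0 := by rw [hn]; push_cast; ring_nf; positivity
  have hK : (2 * (K : ℚ) + 1) ≠ 0 := by positivity
  have hK' : (2 * ((K + 1 : ℕ) : ℚ) - 1) = 2 * (K : ℚ) + 1 := by push_cast; ring
  have hK1 : (K : ℚ) + 1 ≠ 0 := by positivity
  rw [hK', prod_range_succ, Nat.factorial_succ]
  have := hO K
  have := hO (n + K)
  have := hf K
  have := hf l
  have := hf (n + K)
  have := hf (l + (n + K))
  generalize ∏ i ∈ range K, (2 * (i : ℚ) + 1) = o1 at *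
  generalize ∏ i ∈ range (n + K), (2 * (i : ℚ) + 1) = o2 at *
  rw [show (-4 : ℚ) ^ (K + 1) = (-1) ^ (K + 1) * (2 ^ (K + 1) * 2 ^ (K + 1)) by
    rw [← mul_pow, ← mul_pow]; norm_num]
  push_cast
  field_simp
  ring

theorem factorial_add_eq (a b : ℕ) :
    ((a + b).factorial : ℚ) = a.factorial * ∏ i ∈ range b, ((a : ℚ) + b - i) := by
  induction b with
  | zero => simp
  | succ b ih =>
    rw [← add_assoc, Nat.factorial_succ, prod_range_succ']
    push_cast
    rw [ih]
    have : ∀ i ∈ range b, ((a : ℚ) + (b + 1) - (i + 1)) = a + b - i := fun i _ ↦ by ring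
    rw [prod_congr rfl this]
    ring

theorem summand_eq (j l n : ℕ) (hn : n = 2 * j + 2 * l + 5) :
    (-4 : ℚ) ^ (2 * j + l + 4) / (((2 * (2 * j + l + 4)).choose (2 * j + l + 4) : ℕ) : ℚ) *
        (((2 * n + 2 * (2 * j + l + 3)).choose (2 * (2 * j + l + 3)) : ℕ) : ℚ) /
        (((2 * j + l + 4 : ℕ) : ℚ) * (2 * (2 * j + l + 4 : ℕ) - 1)) *
          (((2 * n - 2).choose l : ℕ) : ℚ) =
      (-1) ^ l * 4 ^ (n - 1) * 3 *
        (∏ i ∈ range (j + 2 * l + 3), ((n : ℚ) + 2 * (j + 2 + i))) *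
        (∏ i ∈ range j, (3 * (n : ℚ) + 2 * (i + 1))) *
        (∏ i ∈ range (2 * j + 3), ((n : ℚ) - (i + 1))) /
        (n * (2 * n - 1) * (n - 1).factorial *
          ∏ i ∈ range (j + 1), ((n : ℚ) ^ 2 - 4 * ((i : ℚ) + 1) ^ 2)) := by
  rw [summand_eq_prod_odd (2 * j + l + 3) l n (by omega)]
  have hA : ∏ i ∈ range (n + (2 * j + l + 3)), (2 * (i : ℚ) + 1) =
      (∏ i ∈ range (2 * j + l + 3 + 1), (2 * (i : ℚ) + 1)) *
        ((∏ i ∈ range (j + 2 * l + 3), ((n : ℚ) + 2 * (j + 2 + i))) * (3 * n) *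
          ∏ i ∈ range j, (3 * (n : ℚ) + 2 * (i + 1))) := by
    rw [show n + (2 * j + l + 3) = (2 * j + l + 3 + 1) + ((j + 2 * l + 3) + 1 + j) by omega,
      prod_range_add (fun i : ℕ ↦ 2 * (i : ℚ) + 1),
      prod_range_add (fun i : ℕ ↦ 2 * ((2 * j + l + 3 + 1 + i : ℕ) : ℚ) + 1),
      prod_range_succ _ (j + 2 * l + 3)]
    congr 2
    · congr 1
      · refine prod_congr rfl fun i _ ↦ ?_
        rw [hn]; push_cast; ring
      · rw [hn]; push_cast; ring
    · refine prod_congr rfl fun i _ ↦ ?_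
      rw [hn]; push_cast; ring
  have hO1 : ∏ i ∈ range (2 * j + l + 3 + 1), (2 * (i : ℚ) + 1) =
      (∏ i ∈ range (l + 1), (2 * (i : ℚ) + 1)) *
        (n * ∏ i ∈ range (j + 1), ((n : ℚ) ^ 2 - 4 * ((i : ℚ) + 1) ^ 2)) := by
    rw [← prod_range_symm, show 2 * j + l + 3 + 1 = (l + 1) + (2 * (j + 1) + 1) by ring,
      prod_range_add]
    congr 1
    refine prod_congr rfl fun i _ ↦ ?_
    rw [hn]; push_cast; ring
  have hl : ((2 * l + 1).factorial : ℚ) =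
      2 ^ l * l.factorial * ∏ i ∈ range (l + 1), (2 * (i : ℚ) + 1) := by
    rw [Nat.factorial_succ, prod_range_succ]
    push_cast
    rw [factorial_two_mul_eq]
    ring
  have hR : ((n - 1).factorial : ℚ) =
      2 ^ l * l.factorial * (∏ i ∈ range (l + 1), (2 * (i : ℚ) + 1)) *
        ∏ i ∈ range (2 * j + 3), ((n : ℚ) - (i + 1)) := by
    rw [show n - 1 = (2 * l + 1) + (2 * j + 3) by omega, factorial_add_eq, hl]
    congr 1
    refine prod_congr rfl fun i _ ↦ ?_
    rw [hn]; push_cast; ring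
  have hO0 : ∀ m : ℕ, (∏ i ∈ range m, (2 * (i : ℚ) + 1)) ≠ 0 := fun m ↦
    prod_ne_zero_iff.2 fun i _ ↦ by positivity
  have h1 := hO0 (2 * j + l + 3 + 1)
  have h2 := hO0 (l + 1)
  have hn0 : (n : ℚ) ≠ 0 := by rw [hn]; positivity
  have hn1 : (2 * (n : ℚ) - 1) ≠ 0 := by rw [hn]; push_cast; ring_nf; positivity
  have hf : ((n - 1).factorial : ℚ) ≠ 0 := by positivity
  have hl0 : (l.factorial : ℚ) ≠ 0 := by positivity
  rw [hR] at hf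
  have hR0 := right_ne_zero_of_mul hf
  rw [hO1] at h1
  have hQ0 := right_ne_zero_of_mul (right_ne_zero_of_mul h1)
  rw [hA, hR, hO1]
  generalize ∏ i ∈ range (l + 1), (2 * (i : ℚ) + 1) = o at *
  generalize ∏ i ∈ range (j + 1), ((n : ℚ) ^ 2 - 4 * ((i : ℚ) + 1) ^ 2) = Q at *
  generalize ∏ i ∈ range (2 * j + 3), ((n : ℚ) - (i + 1)) = R at *
  generalize ∏ i ∈ range j, (3 * (n : ℚ) + 2 * (i + 1)) = B at *
  generalize ∏ i ∈ range (j + 2 * l + 3), ((n : ℚ) + 2 * (j + 2 + i)) = A at *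
  have h4 : (4 : ℚ) ^ (n - 1) = 2 ^ (n + (2 * j + l + 3)) * 2 ^ l := by
    rw [← pow_add, show (4 : ℚ) = 2 ^ 2 by norm_num, ← pow_mul]
    congr 1
    omega
  have hs : (-1 : ℚ) ^ (2 * j + l + 3 + 1) = (-1) ^ l := by
    rw [show 2 * j + l + 3 + 1 = 2 * (j + 2) + l by ring, pow_add, pow_mul]
    norm_num
  rw [h4, hs]
  field_simp

/-- `u` is a principal unit at `p`, i.e. `u ≡ 1 (mod p)`. -/
def IsOneUnit (p : ℕ) (u : ℚ) : Prop := padicNorm p (u - 1) < 1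

namespace IsOneUnit

theorem one {p : ℕ} : IsOneUnit p 1 := by simp [IsOneUnit]

variable {p : ℕ} [Fact p.Prime] {u v : ℚ}

theorem norm_eq_one (hu : IsOneUnit p u) : padicNorm p u = 1 := by
  have h : padicNorm p (u - 1) ≠ padicNorm p 1 := by
    rw [padicNorm.one]
    exact hu.ne
  have := padicNorm.add_eq_max_of_ne h
  rwa [sub_add_cancel, padicNorm.one, max_eq_right hu.le] at this

theorem ne_zero (hu : IsOneUnit p u) : u ≠ 0 := by
  rintro rfl
  simpa using hu.norm_eq_one

theorem mul (hu : IsOneUnit p u) (hv : IsOneUnit p v) : IsOneUnit p (u * v) := by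
  have h : u * v - 1 = (u - 1) * v + (v - 1) := by ring
  rw [IsOneUnit, h]
  refine padicNorm.nonarchimedean.trans_lt (max_lt ?_ hv)
  rwa [padicNorm.mul, hv.norm_eq_one, mul_one]

theorem inv (hu : IsOneUnit p u) : IsOneUnit p u⁻¹ := by
  have h : u⁻¹ - 1 = -((u - 1) / u) := by
    have := hu.ne_zero
    field_simp
    ring
  rw [IsOneUnit, h, padicNorm.neg, padicNorm.div, hu.norm_eq_one, div_one]
  exact hu

theorem div (hu : IsOneUnit p u) (hv : IsOneUnit p v) : IsOneUnit p (u / v) :=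
  div_eq_mul_inv u v ▸ hu.mul hv.inv

theorem pow (hu : IsOneUnit p u) (m : ℕ) : IsOneUnit p (u ^ m) := by
  induction m with
  | zero => simpa using one
  | succ m ih => rw [pow_succ]; exact ih.mul hu

theorem prod {ι : Type*} {s : Finset ι} {f : ι → ℚ} (h : ∀ i ∈ s, IsOneUnit p (f i)) :
    IsOneUnit p (∏ i ∈ s, f i) :=
  prod_induction f (IsOneUnit p) (fun _ _ ↦ mul) one h

theorem of_natModEq {m : ℕ} (h : m ≡ 1 [MOD p]) : IsOneUnit p m := by
  have : ((m : ℚ) - 1) = ((m - 1 : ℤ) : ℚ) := by push_cast; ring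
  rw [IsOneUnit, this, padicNorm.int_lt_one_iff]
  exact_mod_cast (Int.natCast_modEq_iff.2 h).symm.dvd

theorem add_mul_pow_div {s : ℕ} {a : ℤ} (c : ℤ) (ha : ¬ (p : ℤ) ^ s ∣ a) :
    IsOneUnit p ((c * (p : ℚ) ^ s + a) / a) := by
  have ha0 : (a : ℚ) ≠ 0 := by
    rintro h
    exact ha (by simp [Int.cast_eq_zero.1 h])
  have h : (c * (p : ℚ) ^ s + a) / a - 1 = c * (((p ^ s : ℕ) : ℤ) : ℚ) / a := by
    field_simp
    push_cast
    ring
  have ha' : padicNorm p (((p ^ s : ℕ) : ℤ) : ℚ) < padicNorm p a := by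
    have h1 := (padicNorm.dvd_iff_norm_le (p := p) (n := s) (z := ((p ^ s : ℕ) : ℤ))).1 dvd_rfl
    have h2 := mt (padicNorm.dvd_iff_norm_le (p := p) (n := s) (z := a)).2 (by exact_mod_cast ha)
    exact h1.trans_lt (not_le.1 h2)
  have hpos : 0 < padicNorm p a := (padicNorm.nonneg _).trans_lt ha'
  rw [IsOneUnit, h, padicNorm.div, padicNorm.mul, div_lt_one hpos]
  exact (mul_le_of_le_one_left (padicNorm.nonneg _) (padicNorm.of_int c)).trans_lt ha'

end IsOneUnit

theorem prod_eq_prod_mul_prod_div {ι : Type*} (s : Finset ι) (f g : ι → ℚ)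
    (hg : ∀ i ∈ s, g i ≠ 0) : ∏ i ∈ s, f i = (∏ i ∈ s, g i) * ∏ i ∈ s, f i / g i := by
  rw [← prod_mul_distrib]
  exact prod_congr rfl fun i hi ↦ (mul_div_cancel₀ _ (hg i hi)).symm

theorem prod_range_two_mul_add (a m : ℕ) :
    ∏ i ∈ range m, (2 * ((a : ℚ) + 1 + i)) = 2 ^ m * ((a + m).factorial / a.factorial) := by
  induction m with
  | zero => simp [Nat.factorial_ne_zero]
  | succ m ih =>
    rw [prod_range_succ, ih, ← add_assoc, Nat.factorial_succ]
    push_cast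
    ring

theorem prod_range_neg_add_one (m : ℕ) :
    ∏ i ∈ range m, (-((i : ℚ) + 1)) = (-1) ^ m * m.factorial := by
  induction m with
  | zero => simp
  | succ m ih =>
    rw [prod_range_succ, ih, Nat.factorial_succ]
    push_cast
    ring

theorem prod_range_neg_four_mul_sq (m : ℕ) :
    ∏ i ∈ range m, (-(4 * ((i : ℚ) + 1) ^ 2)) = (-4) ^ m * (m.factorial : ℚ) ^ 2 := by
  induction m with
  | zero => simp
  | succ m ih =>
    rw [prod_range_succ, ih, Nat.factorial_succ]
    push_cast
    ring

theorem not_pow_dvd_of_lt {p s m : ℕ} (h0 : 0 < m) (hm : m < p ^ s) : ¬ (p : ℤ) ^ s ∣ (m : ℤ) := by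
  intro h
  exact absurd (Nat.le_of_dvd h0 (by exact_mod_cast h)) (not_le.2 hm)

theorem not_pow_dvd_two_mul_of_lt {p s m : ℕ} (hp : Odd p) (h0 : 0 < m) (hm : m < p ^ s) :
    ¬ (p : ℤ) ^ s ∣ 2 * (m : ℤ) := by
  intro h
  have h' : p ^ s ∣ 2 * m := by exact_mod_cast h
  have hc : Nat.Coprime (p ^ s) 2 := (Nat.coprime_two_right.2 hp).pow_left s
  exact absurd (Nat.le_of_dvd h0 (hc.dvd_of_dvd_mul_left h')) (not_le.2 hm)

theorem isOneUnit_two_pow {p : ℕ} [hp : Fact p.Prime] (hodd : Odd p) (r : ℕ) :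
    IsOneUnit p (2 ^ (p ^ r - 1)) := by
  have h : 2 ^ (p - 1) ≡ 1 [MOD p] := by
    rw [← Nat.totient_prime hp.out]
    exact Nat.ModEq.pow_totient (Nat.coprime_two_left.2 hodd)
  obtain ⟨c, hc⟩ : p - 1 ∣ p ^ r - 1 := by simpa using Nat.sub_dvd_pow_sub_pow p 1 r
  rw [hc, pow_mul]
  have := IsOneUnit.of_natModEq h
  push_cast at this
  exact this.pow c

theorem isOneUnit_choose {p : ℕ} [hp : Fact p.Prime] (hodd : Odd p) (r : ℕ) :
    IsOneUnit p (((2 * p ^ r - 1).choose (p ^ r - 1) : ℕ) : ℚ) := by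
  apply IsOneUnit.of_natModEq
  have h := Choose.choose_pow_mul_pow_mul_modEq_choose_nat (p := p) (k := r) (a := 2) (b := 1)
  obtain ⟨m, hm⟩ : ∃ m, p ^ r = m + 1 :=
    Nat.exists_eq_succ_of_ne_zero (pow_ne_zero _ hp.out.ne_zero)
  have h2 : (2 * (m + 1)).choose (m + 1) = 2 * (2 * (m + 1) - 1).choose m := by
    have := Nat.add_one_mul_choose_eq (2 * m + 1) m
    rw [show 2 * (m + 1) - 1 = 2 * m + 1 by omega, show 2 * (m + 1) = 2 * m + 1 + 1 by ring]
    nlinarith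
  rw [hm, mul_one, mul_comm, h2] at h
  rw [hm, Nat.add_sub_cancel]
  exact Nat.ModEq.cancel_left_of_coprime (c := 2) (Nat.coprime_two_right.2 hodd) (by simpa using h)

/-- The leading `p`-adic part of a summand, up to the factor `∓3 p ^ (s + 2)`. -/
def leadingTerm (p s J : ℕ) : ℚ :=
  (p : ℚ) ^ s / J * ((2 * J + 1) * ((2 * J).choose J : ℕ) / (2 * 4 ^ J))

theorem exists_oneUnit_summand {p : ℕ} [hp : Fact p.Prime] (hodd : Odd p) (s j l : ℕ)
    (hn : p ^ (s + 1) = 2 * j + 2 * l + 5) :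
    ∃ u, IsOneUnit p u ∧
      -(p : ℚ) ^ (3 * (s + 1)) * (((2 * p ^ (s + 1) - 1).choose (p ^ (s + 1) - 1) : ℕ) : ℚ) ^ 2 /
          ((2 * (p : ℚ) ^ (s + 1) - 1) * 4 ^ (3 * p ^ (s + 1) - 3)) *
        ((-4 : ℚ) ^ (2 * j + l + 4) / (((2 * (2 * j + l + 4)).choose (2 * j + l + 4) : ℕ) : ℚ) *
        (((2 * p ^ (s + 1) + 2 * (2 * j + l + 3)).choose (2 * (2 * j + l + 3)) : ℕ) : ℚ) /
        (((2 * j + l + 4 : ℕ) : ℚ) * (2 * (2 * j + l + 4 : ℕ) - 1)) *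
          (((2 * p ^ (s + 1) - 2).choose l : ℕ) : ℚ)) =
      -((-1) ^ (j + l) * 3 * (p : ℚ) ^ (s + 2)) * (leadingTerm p s (j + 1) * u) := by
  rw [summand_eq j l _ hn]
  have hC := isOneUnit_choose hodd (s + 1)
  have h2 := isOneUnit_two_pow hodd (s + 1)
  generalize (((2 * p ^ (s + 1) - 1).choose (p ^ (s + 1) - 1) : ℕ) : ℚ) = C at *
  set n := p ^ (s + 1) with hn'
  have hnq : (n : ℚ) = (p : ℚ) ^ (s + 1) := by rw [hn']; push_cast; rfl
  rw [prod_eq_prod_mul_prod_div (range (j + 2 * l + 3)) _ (fun i ↦ 2 * ((j + 1 : ℕ) + 1 + (i : ℚ)))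
      (fun i _ ↦ by positivity),
    prod_eq_prod_mul_prod_div (range j) _ (fun i ↦ 2 * ((0 : ℕ) + 1 + (i : ℚ)))
      (fun i _ ↦ by positivity),
    prod_eq_prod_mul_prod_div (range (2 * j + 3)) _ (fun i ↦ -((i : ℚ) + 1))
      (fun i _ ↦ neg_ne_zero.2 (by positivity)),
    prod_eq_prod_mul_prod_div (range (j + 1)) _ (fun i ↦ -(4 * ((i : ℚ) + 1) ^ 2))
      (fun i _ ↦ neg_ne_zero.2 (by positivity)),
    prod_range_two_mul_add, prod_range_two_mul_add, prod_range_neg_add_one,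
    prod_range_neg_four_mul_sq]
  have hUA : IsOneUnit p (∏ i ∈ range (j + 2 * l + 3),
      ((n : ℚ) + 2 * (j + 2 + i)) / (2 * ((j + 1 : ℕ) + 1 + (i : ℚ)))) := by
    refine IsOneUnit.prod fun i hi ↦ ?_
    have := IsOneUnit.add_mul_pow_div 1 (not_pow_dvd_two_mul_of_lt (s := s + 1) (m := j + 2 + i)
      hodd (by omega) (by have := mem_range.1 hi; omega))
    rw [← hnq] at this
    convert this using 1
    push_cast
    ring
  have hUB : IsOneUnit p (∏ i ∈ range j,
      (3 * (n : ℚ) + 2 * (i + 1)) / (2 * ((0 : ℕ) + 1 + (i : ℚ)))) := by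
    refine IsOneUnit.prod fun i hi ↦ ?_
    have := IsOneUnit.add_mul_pow_div 3 (not_pow_dvd_two_mul_of_lt (s := s + 1) (m := i + 1)
      hodd (by omega) (by have := mem_range.1 hi; omega))
    rw [← hnq] at this
    convert this using 1
    push_cast
    ring
  have hUR : IsOneUnit p (∏ i ∈ range (2 * j + 3), ((n : ℚ) - (i + 1)) / (-((i : ℚ) + 1))) := by
    refine IsOneUnit.prod fun i hi ↦ ?_
    have := IsOneUnit.add_mul_pow_div (-1) (not_pow_dvd_of_lt (p := p) (s := s + 1) (m := i + 1)
      (by omega) (by have := mem_range.1 hi; omega))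
    rw [← hnq] at this
    convert this using 1
    push_cast
    rw [div_neg, ← neg_div]
    ring
  have hUQ : IsOneUnit p (∏ i ∈ range (j + 1),
      ((n : ℚ) ^ 2 - 4 * ((i : ℚ) + 1) ^ 2) / (-(4 * ((i : ℚ) + 1) ^ 2))) := by
    refine IsOneUnit.prod fun i hi ↦ ?_
    have h := not_pow_dvd_two_mul_of_lt (s := s + 1) (m := i + 1)
      hodd (by omega) (by have := mem_range.1 hi; omega)
    have := (IsOneUnit.add_mul_pow_div 1 h).mul (IsOneUnit.add_mul_pow_div (-1) h)
    rw [← hnq] at this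
    convert this using 1
    push_cast
    field_simp
    ring
  have hD : IsOneUnit p (1 - 2 * (n : ℚ)) := by
    have := IsOneUnit.add_mul_pow_div (p := p) (s := s + 1) (a := 1) (-2)
      (not_pow_dvd_of_lt (m := 1) one_pos (by omega))
    rw [← hnq] at this
    convert this using 1
    push_cast
    ring
  generalize (∏ i ∈ range (j + 2 * l + 3),
      ((n : ℚ) + 2 * (j + 2 + i)) / (2 * ((j + 1 : ℕ) + 1 + (i : ℚ)))) = UA at *
  generalize (∏ i ∈ range j,
      (3 * (n : ℚ) + 2 * (i + 1)) / (2 * ((0 : ℕ) + 1 + (i : ℚ)))) = UB at *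
  generalize (∏ i ∈ range (2 * j + 3), ((n : ℚ) - (i + 1)) / (-((i : ℚ) + 1))) = UR at *
  generalize (∏ i ∈ range (j + 1),
      ((n : ℚ) ^ 2 - 4 * ((i : ℚ) + 1) ^ 2) / (-(4 * ((i : ℚ) + 1) ^ 2))) = UQ at *
  refine ⟨C ^ 2 * (UA * UB * UR / UQ) / ((1 - 2 * (n : ℚ)) ^ 2 * (2 ^ (n - 1)) ^ 3),
    ((hC.pow 2).mul (((hUA.mul hUB).mul hUR).div hUQ)).div ((hD.pow 2).mul (h2.pow 3)), ?_⟩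
  have hUQ0 := hUQ.ne_zero
  have hD0 := hD.ne_zero
  have hD1 : 2 * (n : ℚ) - 1 ≠ 0 := by
    rw [← neg_ne_zero]
    convert hD0 using 1
    ring
  have hn0 : (n : ℚ) ≠ 0 := by rw [hn]; positivity
  have hp0 : (p : ℚ) ≠ 0 := by exact_mod_cast hp.out.ne_zero
  have e1 : (4 : ℚ) ^ (3 * n - 3) = (2 ^ (n - 1)) ^ 6 := by
    rw [show (4 : ℚ) = 2 ^ 2 by norm_num, ← pow_mul, ← pow_mul]
    congr 1
    omega
  have e2 : (4 : ℚ) ^ (n - 1) = (2 ^ (n - 1)) ^ 2 := by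
    rw [show (4 : ℚ) = 2 ^ 2 by norm_num, ← pow_mul, ← pow_mul]
    congr 1
    omega
  have e3 : (2 : ℚ) ^ (n - 1) = 2 ^ (j + 2 * l + 3) * 2 ^ j * 2 := by
    rw [← pow_add, ← pow_succ]
    congr 1
    omega
  have e4 : (p : ℚ) ^ (3 * (s + 1)) = n ^ 3 := by rw [hnq, ← pow_mul, mul_comm]
  have e6 : (((2 * (j + 1)).choose (j + 1) : ℕ) : ℚ) * (2 * j + 3) =
      (2 * j + 3).factorial / (j + 1).factorial ^ 2 := by
    rw [show 2 * (j + 1) = (j + 1) + (j + 1) by ring, Nat.cast_add_choose,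
      show j + 1 + (j + 1) = 2 * j + 2 by ring, Nat.factorial_succ (2 * j + 2)]
    push_cast
    field_simp
    ring
  have e7 : ((j + 1).factorial : ℚ) = (j + 1) * j.factorial := by
    rw [Nat.factorial_succ]; push_cast; rfl
  have e8 : (2 * ((j + 1 : ℕ) : ℚ) + 1) = 2 * j + 3 := by push_cast; ring
  have e9 : j + 1 + (j + 2 * l + 3) = n - 1 := by omega
  have hf1 : ((n - 1).factorial : ℚ) ≠ 0 := by positivity
  have hf2 : (j.factorial : ℚ) ≠ 0 := by positivity
  have hj1 : (j : ℚ) + 1 ≠ 0 := by positivity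
  rw [leadingTerm, e8, mul_comm (2 * (j : ℚ) + 3), e6, e1, e2, e4, ← hnq, e9, zero_add,
    e7, Nat.factorial_zero]
  have e10 : (-4 : ℚ) ^ (j + 1) = (-1) ^ (j + 1) * 4 ^ (j + 1) := by rw [← mul_pow]; norm_num
  have e11 : ((-1 : ℚ) ^ j) ^ 2 = 1 := by rw [← pow_mul, mul_comm, pow_mul]; norm_num
  have e12 : (-1 : ℚ) ^ (2 * j + 3) = -1 := by
    rw [pow_add, pow_mul]; norm_num
  have e13 : (-1 : ℚ) ^ j ≠ 0 := by simp
  rw [e10, e12, e3, pow_add (-1 : ℚ) j l, pow_succ (-1 : ℚ) j]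
  generalize ((2 * j + 3).factorial : ℚ) = G
  have e14 : (1 - 2 * (n : ℚ)) ^ 2 = (2 * (n : ℚ) - 1) ^ 2 := by ring
  rw [e14]
  push_cast
  field_simp
  rw [hnq]
  ring_nf
  rw [pow_mul (-1 : ℚ) j 2, e11, mul_one]

section PadicNorm

variable {p : ℕ} [hp : Fact p.Prime]

theorem padicNorm_sub_lt_trans {a b c : ℚ} (hab : padicNorm p (a - b) < 1)
    (hbc : padicNorm p (b - c) < 1) : padicNorm p (a - c) < 1 := by
  rw [← sub_add_sub_cancel a b c]
  exact padicNorm.nonarchimedean.trans_lt (max_lt hab hbc)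

theorem padicNorm_sum_sub_sum_lt {ι : Type*} {s : Finset ι} {f g : ι → ℚ}
    (h : ∀ i ∈ s, padicNorm p (f i - g i) < 1) :
    padicNorm p (∑ i ∈ s, f i - ∑ i ∈ s, g i) < 1 := by
  rw [← sum_sub_distrib]
  exact padicNorm.sum_lt' h one_pos

theorem padicNorm_mul_oneUnit_sub_lt {a u : ℚ} (ha : padicNorm p a ≤ 1) (hu : IsOneUnit p u) :
    padicNorm p (a * u - a) < 1 := by
  rw [← mul_sub_one, padicNorm.mul]
  exact (mul_le_of_le_one_left (padicNorm.nonneg _) ha).trans_lt hu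

theorem padicNorm_two (hodd : Odd p) : padicNorm p 2 = 1 := by
  have := (padicNorm.nat_eq_one_iff (p := p) 2).2 fun h ↦ by
    have h2 := Nat.le_of_dvd two_pos h
    have := hp.out.two_le
    obtain ⟨k, hk⟩ := hodd
    omega
  simpa using this

theorem padicNorm_four_pow (hodd : Odd p) (m : ℕ) : padicNorm p (4 ^ m) = 1 := by
  induction m with
  | zero => simp
  | succ m ih =>
    rw [pow_succ, padicNorm.mul, ih, show (4 : ℚ) = 2 * 2 by norm_num, padicNorm.mul,
      padicNorm_two hodd]
    norm_num

theorem padicNorm_natCast_of_lt {m : ℕ} (h0 : 0 < m) (h : m < p) : padicNorm p (m : ℚ) = 1 :=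
  (padicNorm.nat_eq_one_iff m).2 (Nat.not_dvd_of_pos_of_lt h0 h)

theorem padicNorm_pow_div_natCast {s J : ℕ} (hJ : J ≠ 0) (h : ¬ p ^ (s + 1) ∣ J) :
    padicNorm p ((p : ℚ) ^ s / J) ≤ 1 ∧ (¬ p ^ s ∣ J → padicNorm p ((p : ℚ) ^ s / J) < 1) := by
  obtain ⟨v, m, hm, rfl⟩ := Nat.exists_eq_pow_mul_and_not_dvd hJ p hp.out.ne_one
  have hv : v ≤ s := by
    by_contra! hv
    exact h ((pow_dvd_pow p hv).mul_right m)
  obtain ⟨d, rfl⟩ := Nat.exists_eq_add_of_le hv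
  have hp0 : (p : ℚ) ≠ 0 := by exact_mod_cast hp.out.ne_zero
  have e : (p : ℚ) ^ (v + d) / ((p ^ v * m : ℕ) : ℚ) = ((p ^ d : ℕ) : ℚ) / m := by
    push_cast
    rw [pow_add, mul_div_mul_left _ _ (pow_ne_zero _ hp0)]
  rw [e, padicNorm.div, (padicNorm.nat_eq_one_iff m).2 hm, div_one]
  refine ⟨padicNorm.of_nat _, fun hs ↦ (padicNorm.nat_lt_one_iff _).2 (dvd_pow_self p ?_)⟩
  rintro rfl
  exact hs (by simp)

end PadicNorm

theorem cast_choose_succ_mul (n k : ℕ) :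
    (n.choose (k + 1) : ℚ) * (k + 1) = n.choose k * ((n : ℚ) - k) := by
  rcases le_or_gt k n with h | h
  · have := Nat.choose_succ_right_eq n k
    rw [← Nat.cast_sub h]
    exact_mod_cast this
  · simp [Nat.choose_eq_zero_of_lt h, Nat.choose_eq_zero_of_lt (h.trans k.lt_succ_self)]

theorem neg_one_pow_mul_choose_eq_prod (n k : ℕ) :
    (-1) ^ k * (n.choose k : ℚ) = ∏ m ∈ range k, ((m : ℚ) - n) / (m + 1) := by
  induction k with
  | zero => simp
  | succ k ih =>
    rw [prod_range_succ, ← ih]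
    have h := cast_choose_succ_mul n k
    have hk : (k : ℚ) + 1 ≠ 0 := by positivity
    rw [mul_div_assoc', eq_div_iff hk, pow_succ]
    linear_combination (-1) ^ k * (-1) * h

theorem choose_div_four_pow_eq_prod (k : ℕ) :
    ((2 * k).choose k : ℚ) / 4 ^ k = ∏ m ∈ range k, (2 * (m : ℚ) + 1) / (2 * (m + 1)) := by
  induction k with
  | zero => simp
  | succ k ih =>
    rw [prod_range_succ, ← ih]
    have h : ((k : ℚ) + 1) * ((2 * (k + 1)).choose (k + 1) : ℕ) =
        2 * (2 * k + 1) * ((2 * k).choose k : ℕ) := by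
      exact_mod_cast Nat.succ_mul_centralBinom_succ k
    have hk : (k : ℚ) + 1 ≠ 0 := by positivity
    field_simp
    rw [pow_succ]
    linear_combination 2 * 4 ^ k * h

theorem sum_neg_one_pow_mul_choose_div (N : ℕ) :
    ∑ t ∈ range N, (-1 : ℚ) ^ (t + 1) * (N.choose (t + 1) : ℕ) / (t + 1) = -harmonic N := by
  induction N with
  | zero => simp
  | succ N ih =>
    have h1 : ∑ t ∈ range (N + 1), (-1 : ℚ) ^ (t + 1) * ((N + 1).choose (t + 1) : ℕ) = -1 := by
      have h := Int.alternating_sum_range_choose (n := N + 1)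
      rw [sum_range_succ', if_neg (Nat.succ_ne_zero N)] at h
      have h' := congrArg (Int.cast : ℤ → ℚ) h
      push_cast at h'
      simp only [Nat.choose_zero_right, Nat.cast_one] at h'
      linarith
    have h2 : ∀ t ∈ range (N + 1), (-1 : ℚ) ^ (t + 1) * ((N + 1).choose (t + 1) : ℕ) / (t + 1) =
        (-1 : ℚ) ^ (t + 1) * ((N + 1).choose (t + 1) : ℕ) / (N + 1) +
          (-1 : ℚ) ^ (t + 1) * (N.choose (t + 1) : ℕ) / (t + 1) := by
      intro t _
      have h3 : ((N : ℚ) + 1) * (N.choose t : ℕ) = ((N + 1).choose (t + 1) : ℕ) * (t + 1) := by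
        exact_mod_cast Nat.add_one_mul_choose_eq N t
      have h4 : (((N + 1).choose (t + 1) : ℕ) : ℚ) = (N.choose t : ℕ) + (N.choose (t + 1) : ℕ) := by
        exact_mod_cast Nat.choose_succ_succ N t
      have : (t : ℚ) + 1 ≠ 0 := by positivity
      have : (N : ℚ) + 1 ≠ 0 := by positivity
      field_simp
      linear_combination ((N : ℚ) + 1) * h4 + h3
    rw [sum_congr rfl h2, sum_add_distrib, ← sum_div, h1, sum_range_succ, ih, harmonic_succ,
      Nat.choose_succ_self]
    push_cast
    ring

theorem sum_neg_one_pow_div (N : ℕ) :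
    ∑ i ∈ range (2 * N), (-1 : ℚ) ^ i / (i + 1) = harmonic (2 * N) - harmonic N := by
  induction N with
  | zero => simp
  | succ N ih =>
    rw [show 2 * (N + 1) = 2 * N + 1 + 1 by ring, sum_range_succ, sum_range_succ, ih,
      harmonic_succ, harmonic_succ, harmonic_succ, pow_succ, pow_mul]
    push_cast
    field_simp
    ring

theorem fermatQuotient_eq_sum (m : ℕ) :
    ((2 : ℚ) ^ m - 1) / (m + 1 : ℕ) = ∑ i ∈ range m, (m.choose i : ℚ) / (i + 1) / 2 := by
  have h1 : ∑ i ∈ range m, (((m + 1).choose (i + 1) : ℕ) : ℚ) = 2 ^ (m + 1) - 2 := by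
    have h := Nat.sum_range_choose (m + 1)
    rw [sum_range_succ, sum_range_succ'] at h
    have h' := congrArg (Nat.cast : ℕ → ℚ) h
    push_cast at h'
    simp only [Nat.choose_zero_right, Nat.choose_self, Nat.cast_one] at h'
    linarith
  have h2 : ∀ i ∈ range m, (m.choose i : ℚ) / (i + 1) / 2 =
      (((m + 1).choose (i + 1) : ℕ) : ℚ) / (2 * ((m + 1 : ℕ) : ℚ)) := by
    intro i _
    have h3 : ((m : ℚ) + 1) * (m.choose i : ℕ) = ((m + 1).choose (i + 1) : ℕ) * (i + 1) := by
      exact_mod_cast Nat.add_one_mul_choose_eq m i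
    push_cast
    field_simp
    linear_combination h3
  rw [sum_congr rfl h2, ← sum_div, h1]
  push_cast
  field_simp
  ring

theorem padicNorm_harmonic_lt {p : ℕ} [hp : Fact p.Prime] (hodd : Odd p) :
    padicNorm p (harmonic (p - 1)) < 1 := by
  have h : 2 * harmonic (p - 1) =
      ∑ i ∈ range (p - 1), (p : ℚ) / (((i + 1 : ℕ) : ℚ) * ((p - 1 - i : ℕ) : ℚ)) := by
    have hr : harmonic (p - 1) = ∑ i ∈ range (p - 1), ((p - 1 - i : ℕ) : ℚ)⁻¹ := by
      rw [harmonic, ← sum_range_reflect]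
      refine sum_congr rfl fun i hi ↦ ?_
      have hi' := mem_range.1 hi
      rw [show p - 1 - 1 - i + 1 = p - 1 - i by omega]
    rw [two_mul]
    nth_rewrite 2 [hr]
    rw [harmonic, ← sum_add_distrib]
    refine sum_congr rfl fun i hi ↦ ?_
    have hi' := mem_range.1 hi
    have e : ((p - 1 - i : ℕ) : ℚ) = p - 1 - i := by
      rw [Nat.cast_sub (by omega), Nat.cast_sub (by omega)]
      simp
    have h0 : ((p - 1 - i : ℕ) : ℚ) ≠ 0 := by
      have : p - 1 - i ≠ 0 := by omega
      exact_mod_cast this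
    have h1 : ((i + 1 : ℕ) : ℚ) ≠ 0 := by positivity
    have h2 : (p : ℚ) = ((p - 1 - i : ℕ) : ℚ) + ((i + 1 : ℕ) : ℚ) := by rw [e]; push_cast; ring
    rw [h2]
    field_simp
  have h' : padicNorm p (2 * harmonic (p - 1)) < 1 := by
    rw [h]
    refine padicNorm.sum_lt' (fun i hi ↦ ?_) one_pos
    have hi' := mem_range.1 hi
    rw [padicNorm.div, padicNorm.mul, padicNorm_natCast_of_lt (m := i + 1) (by omega) (by omega),
      padicNorm_natCast_of_lt (m := p - 1 - i) (by omega) (by omega), mul_one, div_one]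
    exact padicNorm.padicNorm_p_lt_one_of_prime
  rwa [padicNorm.mul, padicNorm_two hodd, one_mul] at h'

theorem padicNorm_fermatQuotient_add_harmonic_lt {p N : ℕ} [hp : Fact p.Prime]
    (hN : p = 2 * N + 1) :
    padicNorm p (-harmonic N / 2 - ((2 : ℚ) ^ (p - 1) - 1) / p) < 1 := by
  have hodd : Odd p := ⟨N, hN⟩
  have h2N : p - 1 = 2 * N := by omega
  have hq : ((2 : ℚ) ^ (p - 1) - 1) / p =
      ∑ i ∈ range (p - 1), ((p - 1).choose i : ℚ) / (i + 1) / 2 := by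
    rw [← fermatQuotient_eq_sum, Nat.sub_add_cancel hp.out.one_le]
  have hH : -harmonic N / 2 = ∑ i ∈ range (p - 1), (-1 : ℚ) ^ i / (i + 1) / 2 -
      harmonic (p - 1) / 2 := by
    rw [← sum_div, h2N, sum_neg_one_pow_div]
    ring
  rw [hq, hH, sub_right_comm]
  refine padicNorm.sub.trans_lt (max_lt (padicNorm_sum_sub_sum_lt fun i hi ↦ ?_) ?_)
  · have hi' := mem_range.1 hi
    have hu : IsOneUnit p ((-1) ^ i * ((p - 1).choose i : ℚ)) := by
      rw [neg_one_pow_mul_choose_eq_prod]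
      refine IsOneUnit.prod fun m hm ↦ ?_
      have hm' := mem_range.1 hm
      have := IsOneUnit.add_mul_pow_div (p := p) (s := 1) (a := (m + 1 : ℕ)) (-1)
        (not_pow_dvd_of_lt (by omega) (by rw [pow_one]; omega))
      convert this using 1
      push_cast [Nat.cast_sub hp.out.one_le]
      ring
    have ha : padicNorm p ((-1 : ℚ) ^ i / (i + 1) / 2) ≤ 1 := by
      have e : (-1 : ℚ) ^ i = (((-1) ^ i : ℤ) : ℚ) := by push_cast; rfl
      rw [padicNorm.div, padicNorm.div, padicNorm_two hodd, div_one, ← Nat.cast_add_one,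
        padicNorm_natCast_of_lt (by omega) (by omega), div_one, e]
      exact padicNorm.of_int _
    have := padicNorm_mul_oneUnit_sub_lt ha hu
    rw [← padicNorm.neg, neg_sub]
    convert this using 2
    have e : (-1 : ℚ) ^ i * (-1) ^ i = 1 := by rw [← mul_pow]; simp
    linear_combination (-(((p - 1).choose i : ℚ) / (i + 1) / 2)) * e
  · rw [padicNorm.div, padicNorm_two hodd, div_one]
    exact padicNorm_harmonic_lt hodd

theorem padicNorm_sum_choose_sub_fermatQuotient_lt {p N : ℕ} [hp : Fact p.Prime]
    (hN : p = 2 * N + 1) :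
    padicNorm p (∑ t ∈ range N, ((2 * (t + 1)).choose (t + 1) : ℚ) / 4 ^ (t + 1) /
      (2 * ((t + 1 : ℕ) : ℚ)) - ((2 : ℚ) ^ (p - 1) - 1) / p) < 1 := by
  have hodd : Odd p := ⟨N, hN⟩
  refine padicNorm_sub_lt_trans ?_ (padicNorm_fermatQuotient_add_harmonic_lt hN)
  rw [← sum_neg_one_pow_mul_choose_div, sum_div]
  refine padicNorm_sum_sub_sum_lt fun t ht ↦ ?_
  have ht' := mem_range.1 ht
  have hu : IsOneUnit p (∏ m ∈ range (t + 1), (2 * (m : ℚ) + 1 - p) / (2 * m + 1)) := by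
    refine IsOneUnit.prod fun m hm ↦ ?_
    have hm' := mem_range.1 hm
    have := IsOneUnit.add_mul_pow_div (p := p) (s := 1) (a := (2 * m + 1 : ℕ)) (-1)
      (not_pow_dvd_of_lt (by omega) (by rw [pow_one]; omega))
    convert this using 1
    push_cast
    ring
  have ha : padicNorm p ((-1 : ℚ) ^ (t + 1) * (N.choose (t + 1) : ℕ) / (t + 1) / 2) ≤ 1 := by
    have e : (-1 : ℚ) ^ (t + 1) * (N.choose (t + 1) : ℕ) =
      (((-1) ^ (t + 1) * (N.choose (t + 1) : ℕ) : ℤ) : ℚ) := by push_cast; rfl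
    rw [padicNorm.div, padicNorm.div, padicNorm_two hodd, div_one, ← Nat.cast_add_one,
      padicNorm_natCast_of_lt (by omega) (by omega), div_one, e]
    exact padicNorm.of_int _
  have key : ((2 * (t + 1)).choose (t + 1) : ℚ) / 4 ^ (t + 1) = (-1) ^ (t + 1) *
      (N.choose (t + 1) : ℕ) * (∏ m ∈ range (t + 1), (2 * (m : ℚ) + 1 - p) / (2 * m + 1))⁻¹ := by
    rw [eq_mul_inv_iff_mul_eq₀ hu.ne_zero, choose_div_four_pow_eq_prod,
      neg_one_pow_mul_choose_eq_prod, ← prod_mul_distrib]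
    refine prod_congr rfl fun m _ ↦ ?_
    rw [hN]
    push_cast
    field_simp
    ring
  have := padicNorm_mul_oneUnit_sub_lt ha hu.inv
  convert this using 2
  rw [key]
  generalize (∏ m ∈ range (t + 1), (2 * (m : ℚ) + 1 - p) / (2 * m + 1))⁻¹ = w
  push_cast
  field_simp

theorem padicNorm_leadingTerm {p s J : ℕ} [hp : Fact p.Prime] (hodd : Odd p) (hJ : J ≠ 0)
    (h : ¬ p ^ (s + 1) ∣ J) : padicNorm p (leadingTerm p s J) ≤ 1 ∧
      (¬ p ^ s ∣ J → padicNorm p (leadingTerm p s J) < 1) := by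
  have hnorm : padicNorm p ((2 * J + 1) * ((2 * J).choose J : ℕ) / (2 * 4 ^ J)) ≤ 1 := by
    rw [padicNorm.div, padicNorm.mul 2, padicNorm_two hodd, padicNorm_four_pow hodd, one_mul,
      div_one]
    exact_mod_cast padicNorm.of_nat (p := p) ((2 * J + 1) * (2 * J).choose J)
  obtain ⟨h1, h2⟩ := padicNorm_pow_div_natCast hJ h
  rw [leadingTerm, padicNorm.mul]
  exact ⟨mul_le_one₀ h1 (padicNorm.nonneg _) hnorm, fun hs ↦
    (mul_le_of_le_one_right (padicNorm.nonneg _) hnorm).trans_lt (h2 hs)⟩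

theorem padicNorm_leadingTerm_pow_mul_sub_lt {p s t : ℕ} [hp : Fact p.Prime] (hodd : Odd p)
    (hs : s ≠ 0) (ht : 0 < t) (htp : t < p) :
    padicNorm p (leadingTerm p s (p ^ s * t) -
      ((2 * t).choose t : ℚ) / 4 ^ t / (2 * (t : ℚ))) < 1 := by
  have hp0 : (p : ℚ) ≠ 0 := by exact_mod_cast hp.out.ne_zero
  have ht0 : (t : ℚ) ≠ 0 := by exact_mod_cast ht.ne'
  have h4 : IsOneUnit p (((2 ^ (p ^ s - 1)) ^ 2) ^ t) := ((isOneUnit_two_pow hodd s).pow 2).pow t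
  have e4 : (4 : ℚ) ^ (p ^ s * t) = ((2 ^ (p ^ s - 1)) ^ 2) ^ t * 4 ^ t := by
    rw [pow_mul, ← mul_pow, show (4 : ℚ) = 2 ^ 2 by norm_num, ← mul_pow, ← pow_succ,
      Nat.sub_add_cancel (Nat.one_le_pow _ _ hp.out.pos)]
    congr 1
    rw [← pow_mul, ← pow_mul, mul_comm]
  have h1 : IsOneUnit p (2 * ((p ^ s * t : ℕ) : ℚ) + 1) := by
    have : 2 * (p ^ s * t) + 1 ≡ 1 [MOD p] := by
      have hd : p ∣ 2 * (p ^ s * t) := ((dvd_pow_self p hs).mul_right t).mul_left 2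
      simpa using (Nat.modEq_zero_iff_dvd.2 hd).add_right 1
    exact_mod_cast IsOneUnit.of_natModEq this
  have hC : padicNorm p (((2 * (p ^ s * t)).choose (p ^ s * t) : ℚ) -
      ((2 * t).choose t : ℚ)) < 1 := by
    have h := Choose.choose_pow_mul_pow_mul_modEq_choose (p := p) (k := s) (a := 2 * t) (b := t)
    have := (padicNorm.int_lt_one_iff (p := p) _).2 h.symm.dvd
    push_cast at this
    rwa [mul_left_comm] at this
  have hden : padicNorm p (2 * (t : ℚ) * 4 ^ t) = 1 := by
    rw [padicNorm.mul, padicNorm.mul, padicNorm_two hodd, padicNorm_four_pow hodd,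
      padicNorm_natCast_of_lt ht htp]
    norm_num
  have key : leadingTerm p s (p ^ s * t) - ((2 * t).choose t : ℚ) / 4 ^ t / (2 * (t : ℚ)) =
      ((((2 * (p ^ s * t)).choose (p ^ s * t) : ℕ) *
          ((2 * ((p ^ s * t : ℕ) : ℚ) + 1) / ((2 ^ (p ^ s - 1)) ^ 2) ^ t) -
        ((2 * (p ^ s * t)).choose (p ^ s * t) : ℕ)) +
      (((2 * (p ^ s * t)).choose (p ^ s * t) : ℚ) - ((2 * t).choose t : ℚ))) /
        (2 * (t : ℚ) * 4 ^ t) := by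
    have := h4.ne_zero
    rw [leadingTerm, e4]
    generalize ((2 ^ (p ^ s - 1)) ^ 2) ^ t = w at *
    push_cast
    field_simp
    ring
  rw [key, padicNorm.div, hden, div_one]
  exact padicNorm.nonarchimedean.trans_lt
    (max_lt (padicNorm_mul_oneUnit_sub_lt (padicNorm.of_nat _) (h1.div h4)) hC)

theorem padicNorm_sum_leadingTerm_sub_lt {p N s h : ℕ} [hp : Fact p.Prime]
    (hN : p = 2 * N + 1) (hs : s ≠ 0) (hh : p ^ (s + 1) = 2 * h + 1) :
    padicNorm p (∑ i ∈ range (h - 1), leadingTerm p s (1 + i) -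
      ((2 : ℚ) ^ (p - 1) - 1) / p) < 1 := by
  have hodd : Odd p := ⟨N, hN⟩
  have hps : p ≤ p ^ s := Nat.le_self_pow hs p
  have hp2 := hp.out.two_le
  have hhN : 2 * h + 1 = 2 * (p ^ s * N) + p ^ s := by
    have e : p ^ s * p = p ^ s * (2 * N + 1) := congrArg (p ^ s * ·) hN
    rw [← hh, pow_succ, e]
    ring
  refine padicNorm_sub_lt_trans ?_ (padicNorm_sum_choose_sub_fermatQuotient_lt hN)
  set S := (range N).image fun t ↦ p ^ s * (t + 1) - 1 with hS
  have hinj : Set.InjOn (fun t ↦ p ^ s * (t + 1) - 1) (range N : Finset ℕ) := by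
    intro a _ b _ hab
    have ha : 0 < p ^ s * (a + 1) := by positivity
    have hb : 0 < p ^ s * (b + 1) := by positivity
    have : p ^ s * (a + 1) = p ^ s * (b + 1) := by
      simp only at hab
      omega
    have := Nat.eq_of_mul_eq_mul_left (by omega) this
    omega
  have hsub : S ⊆ range (h - 1) := by
    intro i hi
    obtain ⟨t, ht, rfl⟩ := mem_image.1 hi
    have ht' := mem_range.1 ht
    have : p ^ s * (t + 1) ≤ p ^ s * N := Nat.mul_le_mul_left _ (by omega)
    have : 0 < p ^ s * (t + 1) := by positivity
    rw [mem_range]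
    have := hp.out.two_le
    omega
  rw [← sum_sdiff hsub, add_sub_assoc]
  refine padicNorm.nonarchimedean.trans_lt (max_lt (padicNorm.sum_lt' (fun i hi ↦ ?_) one_pos) ?_)
  · obtain ⟨hi1, hi2⟩ := mem_sdiff.1 hi
    have hi' := mem_range.1 hi1
    refine (padicNorm_leadingTerm hodd (by omega) (Nat.not_dvd_of_pos_of_lt (by omega)
      (by omega))).2 ?_
    rintro ⟨c, hc⟩
    apply hi2
    have hc0 : c ≠ 0 := by
      rintro rfl
      omega
    have hcN : c < N + 1 := by
      by_contra! hcN
      have : p ^ s * (N + 1) ≤ p ^ s * c := Nat.mul_le_mul_left _ hcN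
      rw [mul_add, mul_one] at this
      omega
    refine mem_image.2 ⟨c - 1, mem_range.2 (by omega), ?_⟩
    rw [Nat.sub_add_cancel (by omega)]
    omega
  · rw [hS, sum_image hinj]
    refine padicNorm_sum_sub_sum_lt fun t ht ↦ ?_
    have ht' := mem_range.1 ht
    have : 0 < p ^ s * (t + 1) := by positivity
    rw [Nat.add_sub_cancel' (by omega)]
    exact padicNorm_leadingTerm_pow_mul_sub_lt hodd hs (by omega) (by omega)

theorem pcong_of_eq_pow_mul {p m : ℕ} [hp : Fact p.Prime] {a b c : ℚ}
    (h : a - b = (p : ℚ) ^ m * c) (hc : padicNorm p c < 1) : pcong p (m + 1) a b := by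
  rcases eq_or_ne c 0 with rfl | hc0
  · exact Or.inl (sub_eq_zero.1 (by simpa using h))
  have hp0 : (p : ℚ) ≠ 0 := by exact_mod_cast hp.out.ne_zero
  have hp1 : (1 : ℚ) < p := by exact_mod_cast hp.out.one_lt
  refine Or.inr ?_
  rw [h, padicValRat.mul (pow_ne_zero _ hp0) hc0, padicValRat.pow,
    padicValRat.self hp.out.one_lt]
  rw [padicNorm.eq_zpow_of_nonzero hc0, ← zpow_zero (p : ℚ), zpow_lt_zpow_iff_right₀ hp1] at hc
  push_cast
  omega

theorem stmt_16 (p : ℕ) (hp : p.Prime) (hp3 : 3 < p) (r : ℕ) (hr : 2 ≤ r)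
    (P : ℚ)
    (hP : P = -(p : ℚ) ^ (3 * r) * (((2 * p ^ r - 1).choose (p ^ r - 1) : ℕ) : ℚ) ^ 2 /
      ((2 * (p : ℚ) ^ r - 1) * 4 ^ (3 * p ^ r - 3))) :
    pcong p (r + 2)
      (P * ∑ k ∈ Icc ((p ^ r + 3) / 2) (p ^ r - 1),
        (-4) ^ k / (((2 * k).choose k : ℕ) : ℚ) *
          (((2 * p ^ r + 2 * k - 2).choose (2 * k - 2) : ℕ) : ℚ) /
          ((k : ℚ) * (2 * k - 1)) * (((2 * p ^ r - 2).choose (p ^ r - k - 1) : ℕ) : ℚ))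
      (-((-1) ^ ((p ^ r - 1) / 2) * 3 * (p : ℚ) ^ (r + 1) *
        (((2 : ℚ) ^ (p - 1) - 1) / (p : ℚ)))) := by
  obtain ⟨s, rfl⟩ : ∃ s, r = s + 1 := ⟨r - 1, by omega⟩
  have : Fact p.Prime := ⟨hp⟩
  have hodd : Odd p := hp.odd_of_ne_two (by omega)
  obtain ⟨h, hh⟩ := hodd.pow (n := s + 1)
  obtain ⟨N, hN⟩ := hodd
  have hle : p ^ 1 ≤ p ^ (s + 1) := Nat.pow_le_pow_right hp.pos (by omega)
  rw [pow_one] at hle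
  have hIcc : Icc ((p ^ (s + 1) + 3) / 2) (p ^ (s + 1) - 1) = Ico (h + 2) (2 * h + 1) := by
    ext k
    rw [mem_Icc, mem_Ico]
    omega
  rw [hIcc, sum_Ico_eq_sum_range, show 2 * h + 1 - (h + 2) = h - 1 by omega, mul_sum]
  have hsum : ∀ i, ∃ u, i ∈ range (h - 1) → IsOneUnit p u ∧
      P * ((-4) ^ (h + 2 + i) / (((2 * (h + 2 + i)).choose (h + 2 + i) : ℕ) : ℚ) *
          (((2 * p ^ (s + 1) + 2 * (h + 2 + i) - 2).choose (2 * (h + 2 + i) - 2) : ℕ) : ℚ) /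
          (((h + 2 + i : ℕ) : ℚ) * (2 * (h + 2 + i : ℕ) - 1)) *
            (((2 * p ^ (s + 1) - 2).choose (p ^ (s + 1) - (h + 2 + i) - 1) : ℕ) : ℚ)) =
        -((-1) ^ h * 3 * (p : ℚ) ^ (s + 2)) * (leadingTerm p s (1 + i) * u) := by
    intro i
    by_cases hi : i ∈ range (h - 1)
    · have hi' := mem_range.1 hi
      obtain ⟨l, rfl⟩ : ∃ l, h = i + l + 2 := ⟨h - 2 - i, by omega⟩
      obtain ⟨u, hu, hu'⟩ := exists_oneUnit_summand ⟨N, hN⟩ s i l (by omega)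
      refine ⟨u, fun _ ↦ ⟨hu, ?_⟩⟩
      rw [show i + l + 2 + 2 + i = 2 * i + l + 4 by ring,
        show 2 * p ^ (s + 1) + 2 * (2 * i + l + 4) - 2 =
          2 * p ^ (s + 1) + 2 * (2 * i + l + 3) by omega,
        show 2 * (2 * i + l + 4) - 2 = 2 * (2 * i + l + 3) by omega,
        show p ^ (s + 1) - (2 * i + l + 4) - 1 = l by omega, hP, hu', add_comm 1 i,
        pow_add (-1 : ℚ) (i + l) 2]
      norm_num
    · exact ⟨0, fun hi' ↦ absurd hi' hi⟩
  choose u hu using hsum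
  rw [sum_congr rfl fun i hi ↦ (hu i hi).2, ← mul_sum,
    show (p ^ (s + 1) - 1) / 2 = h by omega]
  refine pcong_of_eq_pow_mul (m := s + 2) (c := (-((-1) ^ h * 3)) *
    (∑ i ∈ range (h - 1), leadingTerm p s (1 + i) * u i - ((2 : ℚ) ^ (p - 1) - 1) / p)) (by ring) ?_
  have hnorm : padicNorm p (-((-1) ^ h * 3)) ≤ 1 := by
    exact_mod_cast padicNorm.of_int (p := p) (-((-1) ^ h * 3))
  rw [padicNorm.mul]
  refine (mul_le_of_le_one_left (padicNorm.nonneg _) hnorm).trans_lt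
    (padicNorm_sub_lt_trans (padicNorm_sum_sub_sum_lt fun i hi ↦ ?_)
      (padicNorm_sum_leadingTerm_sub_lt hN (by omega) hh))
  have hi' := mem_range.1 hi
  exact padicNorm_mul_oneUnit_sub_lt (padicNorm_leadingTerm ⟨N, hN⟩ (by omega)
    (Nat.not_dvd_of_pos_of_lt (by omega) (by omega))).1 (hu i hi).1
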